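/- arXiv:1605.01316 — 2 statements merged into one kernel-verified Lean document; each statement's English description precedes it below -/
import Mathlib

section
/- Let φ : ℝ → ℝ be defined by φ(x) = x/(e^x − 1) for x ≠ 0 and φ(0) = 1 (the continuous extension), and define f : ℝ² → ℝ by f(u,v) = φ(u+v) + φ(u−v) − 2φ(u). Then for all u, v ∈ ℝ, 0 ≤ f(u,v) ≤ v²/6. -/
/-- `φ(x) = x/(e^x − 1)` for `x ≠ 0`, continuously extended by `φ(0) = 1`. -/
noncomputable def phiBE (x : ℝ) : ℝ :=
  if x = 0 then 1 else x / (Real.exp x - 1)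

/-- A `C²` function whose second derivative is nonnegative away from `0` is convex. -/
theorem convexOn_univ_of_deriv2_nonneg_off_zero {g : ℝ → ℝ} (hg : ContDiff ℝ 2 g)
    (h : ∀ y, y ≠ 0 → 0 ≤ deriv (deriv g) y) : ConvexOn ℝ Set.univ g := by
  have hc : Continuous (deriv (deriv g)) := by
    have := hg.continuous_iteratedDeriv 2 le_rfl
    simpa [iteratedDeriv_eq_iterate] using this
  have hd : Differentiable ℝ (deriv g) := by
    have := hg.differentiable_iteratedDeriv 1 (by norm_num)
    simpa using this
  refine convexOn_univ_of_deriv2_nonneg (hg.differentiable (by norm_num)) hd fun y => ?_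
  have hcl : IsClosed {y | 0 ≤ deriv (deriv g) y} := isClosed_le continuous_const hc
  have hdense : Dense {y | 0 ≤ deriv (deriv g) y} :=
    (dense_compl_singleton (0 : ℝ)).mono fun y hy => h y hy
  have : y ∈ closure {y | 0 ≤ deriv (deriv g) y} := hdense y
  rw [hcl.closure_eq] at this
  exact this

theorem ConvexOn.two_mul_le_add_sub {g : ℝ → ℝ} (hg : ConvexOn ℝ Set.univ g) (a b : ℝ) :
    2 * g a ≤ g (a + b) + g (a - b) := by
  have := hg.2 (Set.mem_univ (a + b)) (Set.mem_univ (a - b))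
    (by norm_num : (0 : ℝ) ≤ 1 / 2) (by norm_num : (0 : ℝ) ≤ 1 / 2) (by norm_num)
  simp only [smul_eq_mul] at this
  rw [show 1 / 2 * (a + b) + 1 / 2 * (a - b) = a by ring] at this
  linarith

/-- The continuous extension of `y ↦ y * coth y`. -/
noncomputable def mulCoth (y : ℝ) : ℝ :=
  Real.cosh y * (dslope Real.sinh 0 y)⁻¹

theorem mulCoth_of_ne {y : ℝ} (hy : y ≠ 0) : mulCoth y = y * Real.cosh y / Real.sinh y := by
  rw [mulCoth, dslope_of_ne _ hy, slope_def_field]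
  simp
  ring

theorem phiBE_two_mul (y : ℝ) : phiBE (2 * y) = mulCoth y - y := by
  rcases eq_or_ne y 0 with rfl | hy
  · simp [phiBE, mulCoth]
  · have hs : Real.exp y - Real.exp (-y) ≠ 0 := by
      intro h
      have := Real.exp_injective (sub_eq_zero.mp h)
      exact hy (by linarith)
    have he : Real.exp (2 * y) - 1 = Real.exp y * (Real.exp y - Real.exp (-y)) := by
      rw [mul_sub, ← Real.exp_add, ← Real.exp_add]
      simp [two_mul]
    rw [mulCoth_of_ne hy, phiBE, if_neg (by simpa using hy), he, Real.cosh_eq, Real.sinh_eq]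
    have h1 : Real.exp y * Real.exp (-y) = 1 := by simp [← Real.exp_add]
    have := Real.exp_ne_zero y
    field_simp
    linear_combination (-2) * h1

theorem dslope_sinh_ne_zero (y : ℝ) : dslope Real.sinh 0 y ≠ 0 := by
  rcases eq_or_ne y 0 with rfl | hy
  · simp
  · rw [dslope_of_ne _ hy, slope_def_field]
    simpa using hy

theorem contDiff_mulCoth {n : WithTop ℕ∞} : ContDiff ℝ n mulCoth := by
  refine Real.contDiff_cosh.mul (ContDiff.inv ?_ dslope_sinh_ne_zero)
  rw [contDiff_iff_contDiffAt]
  intro y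
  rcases eq_or_ne y 0 with rfl | hy
  · obtain ⟨p, hp⟩ := Real.analyticAt_sinh (x := 0)
    exact (hp.has_fpower_series_dslope_fslope).analyticAt.contDiffAt
  · have : ContDiffAt ℝ n (fun y => Real.sinh y / y) y :=
      Real.contDiff_sinh.contDiffAt.div contDiffAt_id hy
    refine this.congr_of_eventuallyEq ?_
    filter_upwards [isOpen_ne.mem_nhds hy] with z hz
    rw [dslope_of_ne _ hz, slope_def_field]
    simp

theorem deriv_mulCoth {y : ℝ} (hy : y ≠ 0) :
    deriv mulCoth y = Real.cosh y / Real.sinh y - y / Real.sinh y ^ 2 := by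
  have hs : Real.sinh y ≠ 0 := by simpa using hy
  have h := ((hasDerivAt_id y).mul (Real.hasDerivAt_cosh y)).div (Real.hasDerivAt_sinh y) hs
  have he : mulCoth =ᶠ[nhds y] (id * Real.cosh) / Real.sinh := by
    filter_upwards [isOpen_ne.mem_nhds hy] with z hz
    simp [mulCoth_of_ne hz]
  rw [he.deriv_eq, h.deriv]
  simp only [id, Pi.mul_apply]
  field_simp
  linear_combination (-y) * Real.cosh_sq y

theorem deriv_deriv_mulCoth {y : ℝ} (hy : y ≠ 0) :
    deriv (deriv mulCoth) y = 2 * (y * Real.cosh y - Real.sinh y) / Real.sinh y ^ 3 := by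
  have hs : Real.sinh y ≠ 0 := by simpa using hy
  have h := ((Real.hasDerivAt_cosh y).div (Real.hasDerivAt_sinh y) hs).sub
    ((hasDerivAt_id y).div ((Real.hasDerivAt_sinh y).pow 2) (pow_ne_zero 2 hs))
  have he : deriv mulCoth =ᶠ[nhds y] Real.cosh / Real.sinh - id / Real.sinh ^ 2 := by
    filter_upwards [isOpen_ne.mem_nhds hy] with z hz
    simp [deriv_mulCoth hz]
  rw [he.deriv_eq, h.deriv]
  simp only [id, Pi.pow_apply]
  field_simp
  push_cast
  linear_combination (-Real.sinh y ^ 2) * Real.cosh_sq y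

theorem mul_sinh_nonneg (y : ℝ) : 0 ≤ y * Real.sinh y := by
  rcases le_total 0 y with h | h
  · exact mul_nonneg h (Real.sinh_nonneg_iff.mpr h)
  · exact mul_nonneg_of_nonpos_of_nonpos h (Real.sinh_nonpos_iff.mpr h)

theorem monotone_mul_cosh_sub_sinh :
    Monotone fun y : ℝ => y * Real.cosh y - Real.sinh y := by
  have h (y : ℝ) : HasDerivAt (fun y : ℝ => y * Real.cosh y - Real.sinh y)
      (y * Real.sinh y) y := by
    refine (((hasDerivAt_id' y).mul (Real.hasDerivAt_cosh y)).sub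
      (Real.hasDerivAt_sinh y)).congr_deriv ?_
    ring
  exact monotone_of_deriv_nonneg (fun y => (h y).differentiableAt)
    fun y => (h y).deriv ▸ mul_sinh_nonneg y

theorem sinh_mul_sinh_mul_cosh_sub_nonneg (y : ℝ) :
    0 ≤ Real.sinh y * (Real.sinh y * Real.cosh y - y) := by
  have hc := Real.one_le_cosh y
  rcases le_total 0 y with h | h
  · have h1 := Real.sinh_nonneg_iff.mpr h
    have h2 := Real.self_le_sinh_iff.mpr h
    exact mul_nonneg h1 (by nlinarith)
  · have h1 := Real.sinh_nonpos_iff.mpr h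
    have h2 := Real.sinh_le_self_iff.mpr h
    exact mul_nonneg_of_nonpos_of_nonpos h1 (by nlinarith)

theorem monotone_sinh_cube_sub :
    Monotone fun y : ℝ => Real.sinh y ^ 3 - 3 * (y * Real.cosh y - Real.sinh y) := by
  have h (y : ℝ) : HasDerivAt
      (fun y : ℝ => Real.sinh y ^ 3 - 3 * (y * Real.cosh y - Real.sinh y))
      (3 * (Real.sinh y * (Real.sinh y * Real.cosh y - y))) y := by
    refine (((Real.hasDerivAt_sinh y).pow 3).sub ((((hasDerivAt_id' y).mul
      (Real.hasDerivAt_cosh y)).sub (Real.hasDerivAt_sinh y)).const_mul 3)).congr_deriv ?_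
    push_cast
    ring
  exact monotone_of_deriv_nonneg (fun y => (h y).differentiableAt)
    fun y => (h y).deriv ▸ mul_nonneg (by norm_num) (sinh_mul_sinh_mul_cosh_sub_nonneg y)

theorem deriv_deriv_mulCoth_nonneg {y : ℝ} (hy : y ≠ 0) : 0 ≤ deriv (deriv mulCoth) y := by
  rw [deriv_deriv_mulCoth hy]
  rcases le_total 0 y with h | h
  · have h1 := monotone_mul_cosh_sub_sinh h
    have h2 := Real.sinh_nonneg_iff.mpr h
    simp only [zero_mul, Real.sinh_zero, sub_zero] at h1
    positivity
  · have h1 := monotone_mul_cosh_sub_sinh h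
    have h2 := Real.sinh_nonpos_iff.mpr h
    simp only [zero_mul, Real.sinh_zero, sub_zero] at h1
    exact div_nonneg_of_nonpos (by linarith) (Odd.pow_nonpos (by decide) h2)

theorem deriv_deriv_mulCoth_le {y : ℝ} (hy : y ≠ 0) : deriv (deriv mulCoth) y ≤ 2 / 3 := by
  have hs : Real.sinh y ≠ 0 := by simpa using hy
  have hq : 0 ≤ (Real.sinh y ^ 3 - 3 * (y * Real.cosh y - Real.sinh y)) / Real.sinh y ^ 3 := by
    rcases le_total 0 y with h | h
    · have h1 := monotone_sinh_cube_sub h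
      have h2 := Real.sinh_nonneg_iff.mpr h
      simp only [zero_mul, Real.sinh_zero, sub_zero, mul_zero, ne_eq, OfNat.ofNat_ne_zero,
        not_false_eq_true, zero_pow] at h1
      exact div_nonneg (by linarith) (pow_nonneg h2 3)
    · have h1 := monotone_sinh_cube_sub h
      have h2 := Real.sinh_nonpos_iff.mpr h
      simp only [zero_mul, Real.sinh_zero, sub_zero, mul_zero, ne_eq, OfNat.ofNat_ne_zero,
        not_false_eq_true, zero_pow] at h1
      exact div_nonneg_of_nonpos (by linarith) (Odd.pow_nonpos (by decide) h2)
  rw [sub_div, div_self (pow_ne_zero 3 hs)] at hq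
  rw [deriv_deriv_mulCoth hy]
  rw [mul_div_assoc] at hq ⊢
  linarith

theorem convexOn_mulCoth : ConvexOn ℝ Set.univ mulCoth :=
  convexOn_univ_of_deriv2_nonneg_off_zero contDiff_mulCoth fun _ => deriv_deriv_mulCoth_nonneg

theorem convexOn_sq_div_three_sub_mulCoth :
    ConvexOn ℝ Set.univ fun y => y ^ 2 / 3 - mulCoth y := by
  have hd : Differentiable ℝ mulCoth :=
    (contDiff_mulCoth (n := 1)).differentiable (by norm_num)
  have hd' : Differentiable ℝ (deriv mulCoth) := by
    simpa using (contDiff_mulCoth (n := 2)).differentiable_iteratedDeriv 1 (by norm_num)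
  have h1 : deriv (fun y => y ^ 2 / 3 - mulCoth y) = fun y => 2 / 3 * y - deriv mulCoth y := by
    ext y
    refine (HasDerivAt.sub ?_ (hd y).hasDerivAt).deriv
    refine (((hasDerivAt_id' y).pow 2).div_const 3).congr_deriv ?_
    push_cast
    ring
  refine convexOn_univ_of_deriv2_nonneg_off_zero
    (((contDiff_id.pow 2).div_const 3).sub contDiff_mulCoth) fun y hy => ?_
  have h2 := ((hasDerivAt_id y).const_mul (2 / 3 : ℝ)).sub (hd' y).hasDerivAt
  have h3 : deriv (fun y => 2 / 3 * y - deriv mulCoth y) y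
      = 2 / 3 * 1 - deriv (deriv mulCoth) y := h2.deriv
  rw [h1, h3]
  linarith [deriv_deriv_mulCoth_le hy]

/-- Lemma B.1: the function `f(u,v) = φ(u+v) + φ(u−v) − 2φ(u)` satisfies
`0 ≤ f(u,v) ≤ v²/6` for all real `u, v`. -/
theorem phiBE_combination_bounds (u v : ℝ) :
    0 ≤ phiBE (u + v) + phiBE (u - v) - 2 * phiBE u ∧
    phiBE (u + v) + phiBE (u - v) - 2 * phiBE u ≤ v ^ 2 / 6 := by
  obtain ⟨a, rfl⟩ : ∃ a, u = 2 * a := ⟨u / 2, by ring⟩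
  obtain ⟨b, rfl⟩ : ∃ b, v = 2 * b := ⟨v / 2, by ring⟩
  rw [← mul_add, ← mul_sub, phiBE_two_mul, phiBE_two_mul, phiBE_two_mul]
  have h1 := convexOn_mulCoth.two_mul_le_add_sub a b
  have h2 := convexOn_sq_div_three_sub_mulCoth.two_mul_le_add_sub a b
  constructor <;> linarith
end

section
/- Define h : (0,∞) × (0,∞) → ℝ by h(u,v) = (u − v)/(cosh u − cosh v) for u ≠ v and h(u,u) = 1/sinh u (the limiting value). Then h is strictly positive, symmetric (h(u,v) = h(v,u)), and strictly decreasing in each of its arguments: for all 0 < u < u' and v > 0, h(u',v) < h(u,v), and for all u > 0 and 0 < v < v', h(u,v') < h(u,v). -/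
/-- `h(u,v) = (u − v)/(cosh u − cosh v)` for `u ≠ v`, with the limiting value
`h(u,u) = 1/sinh u` on the diagonal. -/
noncomputable def hBE (u v : ℝ) : ℝ :=
  if u = v then 1 / Real.sinh u else (u - v) / (Real.cosh u - Real.cosh v)

open Set in
theorem StrictConvexOn.strictMono_dslope {f : ℝ → ℝ} (hf : StrictConvexOn ℝ univ f) {a : ℝ}
    (hd : DifferentiableAt ℝ f a) : StrictMono (dslope f a) := by
  intro x y hxy
  rcases eq_or_ne x a with rfl | hx
  · rw [dslope_same, dslope_of_ne f hxy.ne']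
    exact hf.lt_slope_of_hasDerivAt (mem_univ _) (mem_univ _) hxy hd.hasDerivAt
  rcases eq_or_ne y a with rfl | hy
  · rw [dslope_same, dslope_of_ne f hx, slope_comm]
    exact hf.slope_lt_of_hasDerivAt (mem_univ _) (mem_univ _) hxy hd.hasDerivAt
  rw [dslope_of_ne f hx, dslope_of_ne f hy, slope_def_field, slope_def_field]
  exact hf.secant_strict_mono (mem_univ _) (mem_univ _) (mem_univ _) hx hy hxy

theorem Real.strictConvexOn_cosh : StrictConvexOn ℝ Set.univ Real.cosh :=
  StrictMono.strictConvexOn_univ_of_deriv Real.continuous_cosh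
    (by rw [Real.deriv_cosh]; exact Real.sinh_strictMono)

theorem hBE_eq_inv_dslope (u v : ℝ) : hBE u v = (dslope Real.cosh v u)⁻¹ := by
  unfold hBE
  split_ifs with h
  · rw [h, dslope_same, Real.deriv_cosh, one_div]
  · rw [dslope_of_ne _ h, slope_def_field, inv_div]

theorem hBE_comm (u v : ℝ) : hBE u v = hBE v u := by
  rcases eq_or_ne u v with rfl | h
  · rfl
  · rw [hBE, hBE, if_neg h, if_neg h.symm, ← neg_sub v u, ← neg_sub (Real.cosh v), neg_div_neg_eq]

theorem dslope_cosh_pos {u v : ℝ} (hu : 0 < u) (hv : 0 < v) : 0 < dslope Real.cosh v u := by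
  rcases eq_or_ne u v with rfl | h
  · rw [dslope_same, Real.deriv_cosh]
    exact Real.sinh_pos_iff.2 hu
  · rw [dslope_of_ne _ h]
    exact Real.cosh_strictMonoOn.slope_pos hv.le hu.le h.symm

theorem hBE_lt_of_lt_left {u u' v : ℝ} (hu : 0 < u) (huu' : u < u') (hv : 0 < v) :
    hBE u' v < hBE u v := by
  rw [hBE_eq_inv_dslope, hBE_eq_inv_dslope]
  exact inv_strictAnti₀ (dslope_cosh_pos hu hv)
    (Real.strictConvexOn_cosh.strictMono_dslope Real.differentiable_cosh.differentiableAt huu')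

/-- Lemma B.3: on `(0,∞) × (0,∞)`, `h` is strictly positive, symmetric, and
strictly decreasing in each of its arguments. -/
theorem hBE_positive_symmetric_decreasing :
    (∀ u v : ℝ, 0 < u → 0 < v → 0 < hBE u v) ∧
    (∀ u v : ℝ, 0 < u → 0 < v → hBE u v = hBE v u) ∧
    (∀ u u' v : ℝ, 0 < u → u < u' → 0 < v → hBE u' v < hBE u v) ∧
    (∀ u v v' : ℝ, 0 < u → 0 < v → v < v' → hBE u v' < hBE u v) := by
  refine ⟨fun u v hu hv => ?_, fun u v _ _ => hBE_comm u v,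
    fun u u' v hu huu' hv => hBE_lt_of_lt_left hu huu' hv, fun u v v' hu hv hvv' => ?_⟩
  · rw [hBE_eq_inv_dslope]
    exact inv_pos.2 (dslope_cosh_pos hu hv)
  · rw [hBE_comm u v', hBE_comm u v]
    exact hBE_lt_of_lt_left hv hvv' hu
end
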